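/- The Belavin R-matrix satisfies the antisymmetry relation: for generic ξ ∈ ℂ, R(−z) = ω · (g^{−1} ⊗ 𝟙) · R(z) · (g ⊗ 𝟙), where −z = e^{iπ(ξ+1)} (i.e. the left-hand side is R evaluated at ξ + 1). -/

import Mathlib

open Complex Matrix Kronecker

noncomputable section

/-- `eπ x = exp(iπx)`; the variables `z, q, p` of the paper are `eπ ξ, eπ ζ, eπ (2τ)`. -/
def eπ (x : ℂ) : ℂ := Complex.exp (Real.pi * Complex.I * x)

/-- Jacobi theta function with characteristics `ϑ[γ₁,γ₂](u,τ)`. -/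
def jTheta (γ₁ γ₂ : ℝ) (u τ : ℂ) : ℂ :=
  ∑' m : ℤ, Complex.exp (Real.pi * Complex.I * ((m : ℂ) + (γ₁ : ℂ)) ^ 2 * τ +
    2 * Real.pi * Complex.I * ((m : ℂ) + (γ₁ : ℂ)) * (u + (γ₂ : ℂ)))

/-- single infinite Pochhammer symbol `(x;s)_∞`. -/
def poch1 (x s : ℂ) : ℂ := ∏' n : ℕ, (1 - x * s ^ n)

/-- double infinite Pochhammer symbol `(x;p₁,p₂)_∞`. -/
def poch2 (x p₁ p₂ : ℂ) : ℂ := ∏' n : ℕ × ℕ, (1 - x * p₁ ^ n.1 * p₂ ^ n.2)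

/-- Jacobi `Θ_s(x)` function. -/
def ThetaF (s x : ℂ) : ℂ := poch1 x s * poch1 (s * x⁻¹) s * poch1 s s

/-- numerator of `1/κ(z²)`, with `z = eπ ξ`, `q = eπ ζ`, `p = eπ (2τ)`. -/
def kappaNum (N : ℕ) (ξ ζ τ : ℂ) : ℂ :=
  poch2 (eπ (2 * N * ζ - 2 * ξ)) (eπ (2 * τ)) (eπ (2 * N * ζ)) *
  poch2 (eπ (2 * ζ + 2 * ξ)) (eπ (2 * τ)) (eπ (2 * N * ζ)) *
  poch2 (eπ (2 * τ - 2 * ξ)) (eπ (2 * τ)) (eπ (2 * N * ζ)) *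
  poch2 (eπ (2 * τ + (2 * N - 2) * ζ + 2 * ξ)) (eπ (2 * τ)) (eπ (2 * N * ζ))

/-- denominator of `1/κ(z²)`: the numerator with `ξ → -ξ`. -/
def kappaDen (N : ℕ) (ξ ζ τ : ℂ) : ℂ := kappaNum N (-ξ) ζ τ

/-- the diagonal matrix `g^{1/2}` with entries `e^{iπj/N}`, `1 ≤ j ≤ N`. -/
def gHalf (N : ℕ) : Matrix (Fin N) (Fin N) ℂ :=
  Matrix.diagonal fun j => eπ ((((j : ℕ) : ℂ) + 1) / N)

/-- the diagonal matrix `g` with entries `ω^j = e^{2iπj/N}`, `1 ≤ j ≤ N`. -/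
def gMat (N : ℕ) : Matrix (Fin N) (Fin N) ℂ :=
  Matrix.diagonal fun j => eπ (2 * (((j : ℕ) : ℂ) + 1) / N)

/-- the shift matrix `h`, `h_{jl} = δ_{j+1,l}` (mod `N`). -/
def hMat (N : ℕ) : Matrix (Fin N) (Fin N) ℂ :=
  Matrix.of fun j l => if (l : ℕ) = ((j : ℕ) + 1) % N then 1 else 0

/-- `I_{(α₁,α₂)} = g^{α₂} h^{α₁}`. -/
def Imat (N : ℕ) (α : Fin N × Fin N) : Matrix (Fin N) (Fin N) ℂ :=
  gMat N ^ (α.2 : ℕ) * hMat N ^ (α.1 : ℕ)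

/-- the coefficient `W_{(α₁,α₂)}(ξ,ζ,τ)`. -/
def Wcoef (N : ℕ) (α : Fin N × Fin N) (ξ ζ τ : ℂ) : ℂ :=
  jTheta (1/2 + (α.1 : ℕ) / N) (1/2 + (α.2 : ℕ) / N) (ξ + ζ / N) τ /
    (N * jTheta (1/2 + (α.1 : ℕ) / N) (1/2 + (α.2 : ℕ) / N) (ζ / N) τ)

/-- the matrix `𝒵(z)`, `z = eπ ξ`. -/
def Zmat (N : ℕ) (ξ ζ τ : ℂ) : Matrix (Fin N × Fin N) (Fin N × Fin N) ℂ :=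
  (eπ (ξ * (2 / N - 2)) * (kappaNum N ξ ζ τ / kappaDen N ξ ζ τ) *
      jTheta (1/2) (1/2) ζ τ / jTheta (1/2) (1/2) (ξ + ζ) τ) •
    ∑ α : Fin N × Fin N, Wcoef N α ξ ζ τ • (Imat N α ⊗ₖ (Imat N α)⁻¹)

/-- the Belavin R-matrix `R(z)`, as a function of `ξ` with `z = eπ ξ`. -/
def Rmat (N : ℕ) (ξ ζ τ : ℂ) : Matrix (Fin N × Fin N) (Fin N × Fin N) ℂ :=
  (gHalf N ⊗ₖ gHalf N) * Zmat N ξ ζ τ * (gHalf N ⊗ₖ gHalf N)⁻¹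

/-- genericity: every theta-function value and κ-value appearing in a denominator is nonzero. -/
def Rgeneric (N : ℕ) (ξ ζ τ : ℂ) : Prop :=
  jTheta (1/2) (1/2) (ξ + ζ) τ ≠ 0 ∧
  (∀ α : Fin N × Fin N,
    jTheta (1/2 + (α.1 : ℕ) / N) (1/2 + (α.2 : ℕ) / N) (ζ / N) τ ≠ 0) ∧
  kappaDen N ξ ζ τ ≠ 0

/-- the flip (permutation) operator `P` on `ℂ^N ⊗ ℂ^N`. -/
def Pflip (N : ℕ) : Matrix (Fin N × Fin N) (Fin N × Fin N) ℂ :=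
  Matrix.of fun a b => if a.1 = b.2 ∧ a.2 = b.1 then 1 else 0

/-- partial transposition in the second tensor factor. -/
def pt2 {N : ℕ} (M : Matrix (Fin N × Fin N) (Fin N × Fin N) ℂ) :
    Matrix (Fin N × Fin N) (Fin N × Fin N) ℂ :=
  Matrix.of fun a b => M (a.1, b.2) (b.1, a.2)

/-- `τ_N` evaluated at `eπ u` (all fractional powers via exponentials). -/
def tauNe (N : ℕ) (ζ u : ℂ) : ℂ :=
  eπ (u * (2 / N - 2)) * ThetaF (eπ (2 * N * ζ)) (eπ (ζ + 2 * u)) /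
    ThetaF (eπ (2 * N * ζ)) (eπ (ζ - 2 * u))

/-- the normalized Belavin R-matrix `R̂(z) = τ_N(q^{1/2}z⁻¹) R(z)`, as a function of `ξ`. -/
def Rhat (N : ℕ) (ξ ζ τ : ℂ) : Matrix (Fin N × Fin N) (Fin N × Fin N) ℂ :=
  tauNe N ζ (ζ / 2 - ξ) • Rmat N ξ ζ τ


lemma eπ_add (x y : ℂ) : eπ (x + y) = eπ x * eπ y := by
  simp only [eπ, mul_add, Complex.exp_add]

lemma eπ_ne (x : ℂ) : eπ x ≠ 0 := Complex.exp_ne_zero _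

lemma eπ_int (n : ℤ) : eπ (2 * n) = 1 := by
  rw [eπ, Complex.exp_eq_one_iff]
  exact ⟨n, by ring⟩

lemma eπ_two : eπ 2 = 1 := by simpa using eπ_int 1

lemma eπ_neg_two : eπ (-2) = 1 := by simpa using eπ_int (-1)

lemma eπ_one : eπ 1 = -1 := by simp [eπ, Complex.exp_pi_mul_I]

lemma jTheta_add_one (a b : ℝ) (u τ : ℂ) :
    jTheta a b (u + 1) τ = eπ (2 * a) * jTheta a b u τ := by
  unfold jTheta
  rw [← tsum_mul_left]
  congr 1
  ext m
  have h := eπ_int m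
  unfold eπ at *
  rw [← Complex.exp_add]
  refine Eq.trans ?_ (mul_one _)
  refine Eq.trans ?_ (congrArg (_ * ·) h)
  rw [← Complex.exp_add]
  congr 1
  ring

lemma kappaNum_congr (N : ℕ) (ξ η ζ τ : ℂ) (h : eπ (2 * ξ) = eπ (2 * η))
    (h' : eπ (-(2 * ξ)) = eπ (-(2 * η))) : kappaNum N ξ ζ τ = kappaNum N η ζ τ := by
  simp only [kappaNum, sub_eq_add_neg, eπ_add, h, h']

lemma kappaNum_add_one (N : ℕ) (ξ ζ τ : ℂ) : kappaNum N (ξ + 1) ζ τ = kappaNum N ξ ζ τ := by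
  apply kappaNum_congr
  · rw [mul_add, eπ_add, mul_one, eπ_two, mul_one]
  · rw [mul_add, neg_add, eπ_add, mul_one, eπ_neg_two, mul_one]

lemma kappaDen_add_one (N : ℕ) (ξ ζ τ : ℂ) : kappaDen N (ξ + 1) ζ τ = kappaDen N ξ ζ τ := by
  unfold kappaDen
  rw [← kappaNum_add_one]
  congr 1
  ring

lemma Wcoef_add_one (N : ℕ) (α : Fin N × Fin N) (ξ ζ τ : ℂ) :
    Wcoef N α (ξ + 1) ζ τ = -(eπ (2 / N) ^ (α.1 : ℕ)) * Wcoef N α ξ ζ τ := by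
  unfold Wcoef
  rw [add_right_comm, jTheta_add_one, mul_div_assoc]
  congr 1
  have : eπ (2 / N) ^ (α.1 : ℕ) = eπ ((α.1 : ℕ) * (2 / N)) := by
    rw [eπ, eπ, ← Complex.exp_nat_mul]
    congr 1
    ring
  rw [this, neg_eq_neg_one_mul, ← eπ_one, ← eπ_add]
  congr 1
  push_cast
  ring

lemma gMat_det (N : ℕ) : IsUnit (gMat N).det := by
  rw [gMat, det_diagonal, isUnit_iff_ne_zero]
  exact Finset.prod_ne_zero_iff.2 fun _ _ => eπ_ne _

lemma gHalf_det (N : ℕ) : IsUnit (gHalf N).det := by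
  rw [gHalf, det_diagonal, isUnit_iff_ne_zero]
  exact Finset.prod_ne_zero_iff.2 fun _ _ => eπ_ne _

lemma h_mul_g (N : ℕ) (hN : 2 ≤ N) : hMat N * gMat N = eπ (2 / N) • (gMat N * hMat N) := by
  have hN0 : (N : ℂ) ≠ 0 := by
    have : N ≠ 0 := by omega
    exact_mod_cast this
  ext j l
  rw [Matrix.smul_apply, gMat, mul_diagonal, diagonal_mul, hMat, of_apply, smul_eq_mul]
  split_ifs with h
  · rw [one_mul, mul_one, ← eπ_add]
    by_cases hj : (j : ℕ) + 1 < N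
    · rw [Nat.mod_eq_of_lt hj] at h
      rw [h]
      congr 1
      push_cast
      ring
    · have hj' : (j : ℕ) + 1 = N := by omega
      rw [hj', Nat.mod_self] at h
      have hj2 : ((j : ℕ) : ℂ) + 1 = N := by exact_mod_cast hj'
      rw [h, hj2, eπ_add]
      have : (2 * (N : ℂ) / N) = 2 := by field_simp
      rw [this, eπ_two]
      simp
  · simp

lemma h_pow_mul_g (N : ℕ) (hN : 2 ≤ N) (a : ℕ) :
    hMat N ^ a * gMat N = eπ (2 / N) ^ a • (gMat N * hMat N ^ a) := by
  induction a with
  | zero => simp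
  | succ k ih =>
    rw [pow_succ, mul_assoc, h_mul_g N hN, mul_smul_comm, ← mul_assoc, ih, smul_mul_assoc,
      smul_smul, pow_succ, mul_assoc, mul_comm (eπ _)]

lemma I_mul_g (N : ℕ) (hN : 2 ≤ N) (α : Fin N × Fin N) :
    Imat N α * gMat N = eπ (2 / N) ^ (α.1 : ℕ) • (gMat N * Imat N α) := by
  unfold Imat
  rw [mul_assoc, h_pow_mul_g N hN, mul_smul_comm, ← mul_assoc, ← mul_assoc, ← pow_succ, ← pow_succ']

lemma Z_mul_g (N : ℕ) (hN : 2 ≤ N) (ξ ζ τ : ℂ) :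
    (gMat N ⊗ₖ (1 : Matrix (Fin N) (Fin N) ℂ)) * Zmat N (ξ + 1) ζ τ =
      eπ (2 / N) • (Zmat N ξ ζ τ * (gMat N ⊗ₖ (1 : Matrix (Fin N) (Fin N) ℂ))) := by
  unfold Zmat
  rw [mul_smul_comm, smul_mul_assoc, Finset.sum_mul, Finset.mul_sum, smul_smul,
    Finset.smul_sum, Finset.smul_sum]
  refine Finset.sum_congr rfl fun α _ => ?_
  rw [mul_smul_comm, smul_mul_assoc, ← mul_kronecker_mul, ← mul_kronecker_mul, I_mul_g N hN,
    one_mul, mul_one, smul_kronecker, smul_smul, smul_smul, smul_smul, Wcoef_add_one,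
    kappaNum_add_one, kappaDen_add_one, add_right_comm, jTheta_add_one]
  congr 1
  have e1 : eπ ((ξ + 1) * (2 / N - 2)) = eπ (ξ * (2 / N - 2)) * eπ (2 / N) := by
    rw [add_mul, one_mul, eπ_add, sub_eq_add_neg (2 / (N : ℂ)), eπ_add (2 / (N : ℂ)),
      eπ_neg_two, mul_one]
  have e2 : eπ (2 * ((1 / 2 : ℝ) : ℂ)) = -1 := by
    rw [← eπ_one]
    congr 1
    push_cast
    ring
  rw [e1, e2]
  simp only [neg_mul, one_mul, div_neg, mul_neg, neg_neg]
  ring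

/-- Antisymmetry: `R(-z) = ω (g⁻¹ ⊗ 𝟙) R(z) (g ⊗ 𝟙)`, where `-z = eπ (ξ + 1)`
and `ω = e^{2iπ/N}`. -/
theorem belavin_antisymmetry (N : ℕ) (hN : 2 ≤ N) (ξ ζ τ : ℂ)
    (hτ : 0 < τ.im) (hζ : 0 < ζ.im)
    (h1 : Rgeneric N ξ ζ τ) (h2 : Rgeneric N (ξ + 1) ζ τ) :
    Rmat N (ξ + 1) ζ τ =
      eπ (2 / N) • (((gMat N)⁻¹ ⊗ₖ (1 : Matrix (Fin N) (Fin N) ℂ)) * Rmat N ξ ζ τ *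
        (gMat N ⊗ₖ (1 : Matrix (Fin N) (Fin N) ℂ))) := by
  have hg := gMat_det N
  have hh := gHalf_det N
  set A := gMat N ⊗ₖ (1 : Matrix (Fin N) (Fin N) ℂ) with hA
  set B := (gMat N)⁻¹ ⊗ₖ (1 : Matrix (Fin N) (Fin N) ℂ) with hB
  have hBA : B * A = 1 := by
    rw [hA, hB, ← mul_kronecker_mul, nonsing_inv_mul _ hg, one_mul, one_kronecker_one]
  have hAB : A * B = 1 := mul_eq_one_comm.1 hBA
  unfold Rmat
  set H := gHalf N ⊗ₖ gHalf N with hH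
  have hHd : IsUnit H.det := by
    rw [hH, det_kronecker]
    exact (hh.pow _).mul (hh.pow _)
  have hAH : A * H = H * A := by
    rw [hA, hH, ← mul_kronecker_mul, ← mul_kronecker_mul, one_mul, mul_one]
    congr 1
    rw [gMat, gHalf, diagonal_mul_diagonal, diagonal_mul_diagonal]
    simp only [mul_comm]
  have hBH : B * H = H * B := by
    calc B * H = B * (H * (A * B)) := by rw [hAB, mul_one]
      _ = B * (A * H) * B := by rw [hAH]; simp only [mul_assoc]
      _ = H * B := by rw [← mul_assoc, hBA, one_mul]
  have hAHi : H⁻¹ * A = A * H⁻¹ := by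
    calc H⁻¹ * A = H⁻¹ * (A * (H * H⁻¹)) := by rw [mul_nonsing_inv _ hHd, mul_one]
      _ = H⁻¹ * (H * A) * H⁻¹ := by rw [← hAH]; simp only [mul_assoc]
      _ = A * H⁻¹ := by rw [← mul_assoc, nonsing_inv_mul _ hHd, one_mul]
  have hZ : Zmat N (ξ + 1) ζ τ = eπ (2 / N) • (B * (Zmat N ξ ζ τ * A)) := by
    rw [← mul_smul_comm, ← Z_mul_g N hN, ← hA, ← mul_assoc, hBA, one_mul]
  rw [hZ, mul_smul_comm, smul_mul_assoc]
  congr 1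
  calc H * (B * (Zmat N ξ ζ τ * A)) * H⁻¹ = (H * B) * Zmat N ξ ζ τ * (A * H⁻¹) := by
        simp only [mul_assoc]
    _ = B * (H * Zmat N ξ ζ τ * H⁻¹) * A := by
        rw [← hBH, ← hAHi]; simp only [mul_assoc]

end
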